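/- With p_i = 1/(d+1) for 1 ≤ i ≤ d+1 and the density ρ_d of the projection of the Dirichlet(1/2, 0, uniform) process, for each 1 ≤ i ≤ d: ∫_{Δ_d} [ (1/x_i)^2 / (Σ_{j=1}^{d+1} 1/x_j)^2 ] ρ_d(x) dx = 3/((d+1)(d+3)), where x_{d+1} := 1 − x_1 − ⋯ − x_d. -/

import Mathlib

open MeasureTheory Set

/-- The standard `d`-simplex in `ℝ^d`. -/
def simplexDelta (d : ℕ) : Set (Fin d → ℝ) :=
  {x | (∀ i, 0 ≤ x i) ∧ ∑ i, x i ≤ 1}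

/-- Extend `x ∈ Δ_d` by the last barycentric coordinate `x_{d+1} = 1 - Σ x_i`. -/
noncomputable def extCoord {d : ℕ} (x : Fin d → ℝ) : Fin (d + 1) → ℝ :=
  Fin.snoc x (1 - ∑ i, x i)

/-- The density on `Δ_d` of the projection of the `Dirichlet(1/2, θ, ν₀)` process,
with weights `p : Fin (d+1) → ℝ`. -/
noncomputable def rhoD (d : ℕ) (θ : ℝ) (p : Fin (d + 1) → ℝ) (x : Fin d → ℝ) : ℝ :=
  ((∏ j, p j) * Real.Gamma (θ + ((d : ℝ) + 1) / 2) /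
      (Real.pi ^ ((d : ℝ) / 2) * Real.Gamma (θ + 1 / 2))) *
    (∏ j, extCoord x j ^ (-(3 : ℝ) / 2)) /
    (∑ j, (p j) ^ 2 / extCoord x j) ^ (θ + ((d : ℝ) + 1) / 2)

theorem aux_gamma {a S : ℝ} (ha : 0 < a) (hS : 0 < S) :
    ∫⁻ r in Ioi (0:ℝ), ENNReal.ofReal (r ^ (-a - 1) * Real.exp (-(S / r)))
      = ENNReal.ofReal (Real.Gamma a * S ^ (-a)) := by
  have h1 := Real.integral_rpow_mul_exp_neg_mul_Ioi ha hS
  have h2 := integral_comp_rpow_Ioi (fun t : ℝ => t ^ (a - 1) * Real.exp (-(S * t)))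
    (p := -1) (by norm_num)
  have h3 : ∫ r in Ioi (0:ℝ), r ^ (-a - 1) * Real.exp (-(S / r)) = Real.Gamma a * S ^ (-a) := by
    have h4 : (1 / S) ^ a * Real.Gamma a = Real.Gamma a * S ^ (-a) := by
      rw [one_div, Real.inv_rpow hS.le, Real.rpow_neg hS.le, mul_comm]
    rw [← h4, ← h1, ← h2]
    refine setIntegral_congr_fun measurableSet_Ioi ?_
    intro r hr
    have hr : 0 < r := hr
    simp only [smul_eq_mul, abs_neg, abs_one, one_mul]
    rw [← Real.rpow_mul hr.le, ← mul_assoc, ← Real.rpow_add hr, Real.rpow_neg_one, div_eq_mul_inv]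
    congr 2
    ring
  have hpos : 0 < Real.Gamma a * S ^ (-a) :=
    mul_pos (Real.Gamma_pos_of_pos ha) (Real.rpow_pos_of_pos hS _)
  rw [← h3, ofReal_integral_eq_lintegral_ofReal]
  · exact Integrable.of_integral_ne_zero (by rw [h3]; exact hpos.ne')
  · refine (ae_restrict_mem measurableSet_Ioi).mono ?_
    intro r hr
    have hr : 0 < r := hr
    simp only [Pi.zero_apply]
    positivity

theorem aux_prod (n : ℕ) (f : Fin n → ℝ → ENNReal) (hf : ∀ j, Measurable (f j)) :
    ∫⁻ s : Fin n → ℝ, ∏ j, f j (s j) = ∏ j, ∫⁻ t, f j t := by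
  induction n with
  | zero => simp [volume_pi]
  | succ n ih =>
    rw [← ((volume_preserving_piFinSuccAbove (fun _ : Fin (n + 1) => ℝ) 0).symm _).lintegral_comp_emb
      (MeasurableEquiv.measurableEmbedding _)]
    simp only [Fin.prod_univ_succ]
    have hm : Measurable (fun s : Fin n → ℝ => ∏ j, f j.succ (s j)) :=
      Finset.measurable_prod _ (fun j _ => (hf _).comp (measurable_pi_apply j))
    rw [← ih (fun j => f j.succ) (fun j => hf _), ← lintegral_prod_mul (hf 0).aemeasurable
      hm.aemeasurable]
    rfl

theorem aux_cone (d : ℕ) (F : (Fin (d + 1) → ℝ) → ENNReal) (hF : Measurable F)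
    (h0 : ∀ s, (∃ j, s j ≤ 0) → F s = 0) :
    ∫⁻ s, F s = ∫⁻ x : Fin d → ℝ, ∫⁻ r in Ioi (0:ℝ),
      ENNReal.ofReal (r ^ d) * F (fun j => r * extCoord x j) := by
  have hsn : Measurable (fun q : (Fin d → ℝ) × ℝ => (Fin.snoc q.1 q.2 : Fin (d + 1) → ℝ)) := by
    refine measurable_pi_lambda _ ?_
    intro j
    refine Fin.lastCases ?_ (fun j => ?_) j
    · simpa using measurable_snd
    · simp only [Fin.snoc_castSucc]
      exact (measurable_pi_apply j).comp measurable_fst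
  have hG : Measurable (fun q : (Fin d → ℝ) × ℝ => F (Fin.snoc q.1 (q.2 - ∑ i, q.1 i))) := by
    refine hF.comp (hsn.comp (measurable_fst.prodMk (measurable_snd.sub ?_)))
    exact Finset.measurable_sum _ (fun i _ => (measurable_pi_apply i).comp measurable_fst)
  have hext : Measurable (fun q : (Fin d → ℝ) × ℝ =>
      ENNReal.ofReal (q.2 ^ d) * F (fun j => q.2 * extCoord q.1 j)) := by
    refine Measurable.mul (by fun_prop) (hF.comp (measurable_pi_lambda _ fun j => ?_))
    refine measurable_snd.mul ?_
    have : Measurable (fun q : (Fin d → ℝ) × ℝ => extCoord q.1) := by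
      refine hsn.comp (measurable_fst.prodMk (measurable_const.sub ?_))
      exact Finset.measurable_sum _ (fun i _ => (measurable_pi_apply i).comp measurable_fst)
    exact (measurable_pi_apply j).comp this
  calc ∫⁻ s, F s = ∫⁻ u : ℝ, ∫⁻ y : Fin d → ℝ, F (Fin.snoc y u) := by
        rw [← ((volume_preserving_piFinSuccAbove (fun _ : Fin (d + 1) => ℝ)
          (Fin.last d)).symm _).lintegral_comp_emb (MeasurableEquiv.measurableEmbedding _)]
        have : ∀ q : ℝ × (Fin d → ℝ), (MeasurableEquiv.piFinSuccAbove (fun _ : Fin (d + 1) => ℝ)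
          (Fin.last d)).symm q = Fin.snoc q.2 q.1 := by
          intro q
          simp [MeasurableEquiv.piFinSuccAbove, Fin.insertNthEquiv]
        simp only [this]
        rw [Measure.volume_eq_prod, lintegral_prod]
        exact (hF.comp (hsn.comp measurable_swap)).aemeasurable
    _ = ∫⁻ y : Fin d → ℝ, ∫⁻ u : ℝ, F (Fin.snoc y u) :=
        lintegral_lintegral_swap (hF.comp (hsn.comp measurable_swap)).aemeasurable
    _ = ∫⁻ y : Fin d → ℝ, ∫⁻ r : ℝ, F (Fin.snoc y (r - ∑ i, y i)) := by
        refine lintegral_congr fun y => ?_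
        exact (lintegral_sub_right_eq_self (fun u => F (Fin.snoc y u)) _).symm
    _ = ∫⁻ r : ℝ, ∫⁻ y : Fin d → ℝ, F (Fin.snoc y (r - ∑ i, y i)) :=
        lintegral_lintegral_swap hG.aemeasurable
    _ = ∫⁻ r in Ioi (0:ℝ), ∫⁻ y : Fin d → ℝ, F (Fin.snoc y (r - ∑ i, y i)) := by
        rw [← lintegral_indicator measurableSet_Ioi]
        refine lintegral_congr fun r => ?_
        by_cases hr : r ∈ Ioi (0:ℝ)
        · simp [hr]
        · rw [indicator_of_notMem hr]
          simp only [mem_Ioi, not_lt] at hr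
          rw [← lintegral_zero (μ := (volume : Measure (Fin d → ℝ)))]
          refine lintegral_congr fun y => h0 _ ?_
          by_contra hcon
          push Not at hcon
          have h1 := hcon (Fin.last d)
          have h2 : ∀ i : Fin d, 0 < y i := fun i => by simpa using hcon i.castSucc
          have h3 : 0 ≤ ∑ i, y i := Finset.sum_nonneg fun i _ => (h2 i).le
          simp at h1
          linarith
    _ = ∫⁻ r in Ioi (0:ℝ), ∫⁻ x : Fin d → ℝ,
          ENNReal.ofReal (r ^ d) * F (fun j => r * extCoord x j) := by
        refine setLIntegral_congr_fun measurableSet_Ioi ?_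
        intro r hr
        have hr : 0 < r := hr
        have hm := Measure.map_addHaar_smul (volume : Measure (Fin d → ℝ)) hr.ne'
        have hy : Measurable (fun y : Fin d → ℝ => F (Fin.snoc y (r - ∑ i, y i))) :=
          hG.comp (measurable_id.prodMk measurable_const)
        have hs : ∀ x : Fin d → ℝ, F (fun j => r * extCoord x j) =
            F (Fin.snoc (r • x) (r - ∑ i, (r • x) i)) := by
          intro x
          congr 1
          funext j
          refine Fin.lastCases ?_ (fun j => ?_) j
          · simp [extCoord, mul_sub, Finset.mul_sum]
          · simp [extCoord]
        have hfin : ENNReal.ofReal (r ^ d) * ENNReal.ofReal |(r ^ d)⁻¹| = 1 := by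
          rw [← ENNReal.ofReal_mul (by positivity), abs_of_pos (by positivity),
            mul_inv_cancel₀ (by positivity), ENNReal.ofReal_one]
        dsimp only
        rw [lintegral_const_mul']
        · simp only [hs]
          rw [← lintegral_map (f := fun y : Fin d → ℝ => F (Fin.snoc y (r - ∑ i, y i)))
            (g := fun x : Fin d → ℝ => r • x) hy (by fun_prop), hm, lintegral_smul_measure,
            Module.finrank_fin_fun, smul_eq_mul, ← mul_assoc, hfin, one_mul]
        · exact ENNReal.ofReal_ne_top
    _ = _ := lintegral_lintegral_swap (hext.comp measurable_swap).aemeasurable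

/-- One-dimensional factor: (unnormalised) inverse-gamma density, as an extended nonnegative real. -/
noncomputable def auxF (a t : ℝ) : ENNReal :=
  (Ioi (0:ℝ)).indicator (fun t => ENNReal.ofReal (t ^ (-a - 1) * Real.exp (-(1 / t)))) t

theorem auxF_meas (a : ℝ) : Measurable (auxF a) := by
  unfold auxF
  refine Measurable.indicator ?_ measurableSet_Ioi
  fun_prop

theorem auxF_int {a : ℝ} (ha : 0 < a) : ∫⁻ t, auxF a t = ENNReal.ofReal (Real.Gamma a) := by
  unfold auxF
  rw [lintegral_indicator measurableSet_Ioi, aux_gamma ha one_pos, Real.one_rpow, mul_one]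

theorem auxF_pos {a t : ℝ} (ht : 0 < t) :
    auxF a t = ENNReal.ofReal (t ^ (-a - 1) * Real.exp (-(1 / t))) := by
  unfold auxF
  rw [indicator_of_mem]
  exact ht

theorem auxF_nonpos {a t : ℝ} (ht : t ≤ 0) : auxF a t = 0 := by
  unfold auxF
  rw [indicator_of_notMem]
  simpa using ht

theorem aux_inner (d : ℕ) (a e : Fin (d + 1) → ℝ) (ha : ∀ j, 0 < a j) (he : ∀ j, 0 < e j) :
    ∫⁻ r in Ioi (0:ℝ), ENNReal.ofReal (r ^ d) * ∏ j, auxF (a j) (r * e j)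
      = ENNReal.ofReal ((∏ j, e j ^ (-a j - 1)) *
          (Real.Gamma (∑ j, a j) * (∑ j, 1 / e j) ^ (-∑ j, a j))) := by
  have hA : 0 < ∑ j, a j := Finset.sum_pos (fun j _ => ha j) Finset.univ_nonempty
  have hS : 0 < ∑ j, 1 / e j :=
    Finset.sum_pos (fun j _ => one_div_pos.2 (he j)) Finset.univ_nonempty
  have hC : 0 ≤ ∏ j, e j ^ (-a j - 1) :=
    Finset.prod_nonneg fun j _ => Real.rpow_nonneg (he j).le _
  rw [ENNReal.ofReal_mul hC, ← aux_gamma hA hS, ← lintegral_const_mul' _ _ ENNReal.ofReal_ne_top]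
  refine setLIntegral_congr_fun measurableSet_Ioi ?_
  intro r hr
  have hr : 0 < r := hr
  dsimp only
  rw [Finset.prod_congr rfl fun j _ => auxF_pos (mul_pos hr (he j)),
    ← ENNReal.ofReal_prod_of_nonneg, ← ENNReal.ofReal_mul (by positivity), ← ENNReal.ofReal_mul hC]
  · congr 1
    rw [Finset.prod_mul_distrib, ← Real.exp_sum]
    have h1 : ∏ j, (r * e j) ^ (-a j - 1)
        = r ^ (-(∑ j, a j) - ((d : ℝ) + 1)) * ∏ j, e j ^ (-a j - 1) := by
      rw [Finset.prod_congr rfl fun j _ => Real.mul_rpow hr.le (he j).le,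
        Finset.prod_mul_distrib, ← Real.rpow_sum_of_pos hr]
      congr 2
      simp [Finset.sum_sub_distrib]
    have h2 : ∑ j, -(1 / (r * e j)) = -((∑ j, 1 / e j) / r) := by
      rw [Finset.sum_neg_distrib, Finset.sum_div]
      congr 1
      refine Finset.sum_congr rfl fun j _ => ?_
      have := he j
      field_simp
    have h3 : r ^ d * r ^ (-(∑ j, a j) - ((d : ℝ) + 1)) = r ^ (-(∑ j, a j) - 1) := by
      rw [← Real.rpow_natCast, ← Real.rpow_add hr]
      congr 1
      ring
    rw [h1, h2, ← h3]
    ring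
  · intro j _
    have := he j
    positivity

theorem rhoD_eq (d : ℕ) (x : Fin d → ℝ) (he : ∀ j, 0 < extCoord x j) :
    rhoD d 0 (fun _ => 1 / ((d : ℝ) + 1)) x =
      Real.Gamma (((d : ℝ) + 1) / 2) / Real.pi ^ (((d : ℝ) + 1) / 2) *
        (∏ j, extCoord x j ^ (-(3 : ℝ) / 2)) /
        (∑ j, 1 / extCoord x j) ^ (((d : ℝ) + 1) / 2) := by
  have hS : 0 < ∑ j, 1 / extCoord x j :=
    Finset.sum_pos (fun j _ => one_div_pos.2 (he j)) Finset.univ_nonempty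
  have hn : (0:ℝ) < 1 / ((d:ℝ) + 1) := by positivity
  have h1 : ∑ j, (1 / ((d:ℝ) + 1)) ^ 2 / extCoord x j
      = (1 / ((d:ℝ) + 1)) ^ 2 * ∑ j, 1 / extCoord x j := by
    rw [Finset.mul_sum]
    refine Finset.sum_congr rfl fun j _ => ?_
    ring
  have h2 : ((1 / ((d:ℝ) + 1)) ^ 2) ^ (((d : ℝ) + 1) / 2) = (1 / ((d:ℝ) + 1)) ^ (d + 1) := by
    rw [← Real.rpow_natCast, ← Real.rpow_natCast, ← Real.rpow_mul hn.le]
    congr 1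
    push_cast
    ring
  have h3 : Real.pi ^ ((d : ℝ) / 2) * Real.Gamma (1 / 2) = Real.pi ^ (((d : ℝ) + 1) / 2) := by
    rw [Real.Gamma_one_half_eq, Real.sqrt_eq_rpow, ← Real.rpow_add Real.pi_pos]
    congr 1
    ring
  unfold rhoD
  simp only [zero_add]
  rw [h1, Real.mul_rpow (by positivity) hS.le, h2, h3]
  simp only [Finset.prod_const, Finset.card_univ, Fintype.card_fin]
  have h4 : 0 < (1 / ((d:ℝ) + 1)) ^ (d + 1) := by positivity
  have h5 : 0 < (∑ j, 1 / extCoord x j) ^ (((d : ℝ) + 1) / 2) := Real.rpow_pos_of_pos hS _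
  have h6 : 0 < Real.pi ^ (((d : ℝ) + 1) / 2) := Real.rpow_pos_of_pos Real.pi_pos _
  generalize (1 / ((d:ℝ) + 1)) ^ (d + 1) = P at *
  field_simp

/-- The exponents: `5/2` at `i`, `1/2` elsewhere. -/
noncomputable def auxA {d : ℕ} (i : Fin d) (j : Fin (d + 1)) : ℝ :=
  1 / 2 + if j = i.castSucc then 2 else 0

theorem auxA_pos {d : ℕ} (i : Fin d) (j : Fin (d + 1)) : 0 < auxA i j := by
  unfold auxA
  split_ifs <;> norm_num

theorem auxA_sum {d : ℕ} (i : Fin d) : ∑ j, auxA i j = ((d : ℝ) + 1) / 2 + 2 := by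
  simp [auxA, Finset.sum_add_distrib]
  ring

theorem auxA_prod {d : ℕ} (i : Fin d) (e : Fin (d + 1) → ℝ) (he : ∀ j, 0 < e j) :
    ∏ j, e j ^ (-auxA i j - 1) = (∏ j, e j ^ (-(3 : ℝ) / 2)) * (1 / (e i.castSucc) ^ 2) := by
  have : ∀ j, e j ^ (-auxA i j - 1)
      = e j ^ (-(3 : ℝ) / 2) * (if j = i.castSucc then 1 / (e j) ^ 2 else 1) := by
    intro j
    unfold auxA
    split_ifs
    · rw [one_div (e j ^ 2), ← Real.rpow_natCast, ← Real.rpow_neg (he j).le, ← Real.rpow_add (he j)]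
      norm_num
    · norm_num
  simp only [this]
  rw [Finset.prod_mul_distrib]
  simp

theorem auxA_gamma {d : ℕ} (i : Fin d) :
    ∏ j, Real.Gamma (auxA i j) = Real.pi ^ (((d : ℝ) + 1) / 2) * (3 / 4) := by
  have hG : Real.Gamma (1 / 2 + 2) = Real.pi ^ ((1:ℝ) / 2) * (3 / 4) := by
    rw [show (1:ℝ) / 2 + 2 = (1 / 2 + 1) + 1 by norm_num, Real.Gamma_add_one (by norm_num),
      Real.Gamma_add_one (by norm_num), Real.Gamma_one_half_eq, Real.sqrt_eq_rpow]
    ring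
  have : ∀ j, Real.Gamma (auxA i j)
      = Real.pi ^ ((1:ℝ) / 2) * (if j = i.castSucc then 3 / 4 else 1) := by
    intro j
    unfold auxA
    split_ifs
    · exact hG
    · rw [add_zero, mul_one, Real.Gamma_one_half_eq, Real.sqrt_eq_rpow]
  simp only [this]
  rw [Finset.prod_mul_distrib]
  simp only [Finset.prod_const, Finset.card_univ, Fintype.card_fin, Finset.prod_ite_eq',
    Finset.mem_univ, if_true]
  rw [← Real.rpow_natCast, ← Real.rpow_mul Real.pi_pos.le]
  congr 2
  push_cast
  ring

theorem mem_simplexDelta_iff {d : ℕ} (x : Fin d → ℝ) :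
    x ∈ simplexDelta d ↔ ∀ j, 0 ≤ extCoord x j := by
  simp [simplexDelta, extCoord, Fin.forall_fin_succ', Fin.snoc_castSucc, Fin.snoc_last]

theorem extCoord_meas {d : ℕ} (j : Fin (d + 1)) :
    Measurable (fun x : Fin d → ℝ => extCoord x j) := by
  refine Fin.lastCases ?_ (fun j => ?_) j
  · simp only [extCoord, Fin.snoc_last]
    fun_prop
  · simp only [extCoord, Fin.snoc_castSucc]
    fun_prop

theorem simplexDelta_meas (d : ℕ) : MeasurableSet (simplexDelta d) := by
  have : simplexDelta d = ⋂ j, {x | 0 ≤ extCoord x j} := by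
    ext x
    simp [mem_simplexDelta_iff]
  rw [this]
  exact MeasurableSet.iInter fun j => measurableSet_le measurable_const (extCoord_meas j)

/-- With `θ = 0` and uniform weights `p_i = 1/(d+1)`, for each `1 ≤ i ≤ d`:
`∫_{Δ_d} (1/x_i²)/(Σ_{j=1}^{d+1} 1/x_j)² ρ_d(x) dx = 3/((d+1)(d+3))`. -/
theorem second_moment_diagonal (d : ℕ) (hd : 1 ≤ d) (i : Fin d) :
    ∫ x in simplexDelta d,
        (1 / (x i) ^ 2) / (∑ j, 1 / extCoord x j) ^ 2 *
          rhoD d 0 (fun _ => 1 / ((d : ℝ) + 1)) x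
      = 3 / (((d : ℝ) + 1) * ((d : ℝ) + 3)) := by
  set G : (Fin d → ℝ) → ℝ := fun x => (1 / (x i) ^ 2) / (∑ j, 1 / extCoord x j) ^ 2 *
          rhoD d 0 (fun _ => 1 / ((d : ℝ) + 1)) x with hG
  have hGm : Measurable G := by
    have := fun j => extCoord_meas (d := d) j
    unfold G rhoD
    fun_prop
  set n2 : ℝ := ((d : ℝ) + 1) / 2 with hn2
  have hn2pos : 0 < n2 := by positivity
  set K : ℝ := Real.Gamma (n2 + 2) * Real.pi ^ n2 / Real.Gamma n2 with hK
  have hg1 : 0 < Real.Gamma n2 := Real.Gamma_pos_of_pos hn2pos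
  have hg2 : 0 < Real.Gamma (n2 + 2) := Real.Gamma_pos_of_pos (by positivity)
  have hpi : 0 < Real.pi ^ n2 := Real.rpow_pos_of_pos Real.pi_pos _
  have hKpos : 0 < K := by positivity
  have hzero : ∀ x ∈ simplexDelta d, (¬ ∀ j, 0 < extCoord x j) → G x = 0 := by
    intro x hx hn
    push Not at hn
    obtain ⟨j, hj⟩ := hn
    have hj0 : extCoord x j = 0 := le_antisymm hj ((mem_simplexDelta_iff x).1 hx j)
    have : ∏ j, extCoord x j ^ (-(3 : ℝ) / 2) = 0 := by
      refine Finset.prod_eq_zero (Finset.mem_univ j) ?_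
      rw [hj0, Real.zero_rpow (by norm_num)]
    simp [hG, rhoD, this]
  have hGpos : ∀ x, (∀ j, 0 < extCoord x j) → G x =
      (1 / (extCoord x i.castSucc) ^ 2) / (∑ j, 1 / extCoord x j) ^ 2 *
      (Real.Gamma n2 / Real.pi ^ n2 *
        (∏ j, extCoord x j ^ (-(3 : ℝ) / 2)) / (∑ j, 1 / extCoord x j) ^ n2) := by
    intro x hx
    simp only [hG]
    rw [rhoD_eq d x hx]
    simp [extCoord, hn2]
  have hGnn : ∀ x ∈ simplexDelta d, 0 ≤ G x := by
    intro x hx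
    by_cases h : ∀ j, 0 < extCoord x j
    · rw [hGpos x h]
      have h1 : 0 ≤ ∏ j, extCoord x j ^ (-(3 : ℝ) / 2) :=
        Finset.prod_nonneg fun j _ => Real.rpow_nonneg (h j).le _
      have h2 : 0 ≤ ∑ j, 1 / extCoord x j :=
        Finset.sum_nonneg fun j _ => one_div_nonneg.2 (h j).le
      positivity
    · rw [hzero x hx h]
  have hcone := aux_cone d (fun s => ∏ j, auxF (auxA i j) (s j))
    (Finset.measurable_prod _ fun j _ => (auxF_meas _).comp (measurable_pi_apply j))
    (by
      rintro s ⟨j, hj⟩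
      exact Finset.prod_eq_zero (Finset.mem_univ j) (auxF_nonpos hj))
  have hin : ∀ x : Fin d → ℝ, (∫⁻ r in Ioi (0:ℝ),
      ENNReal.ofReal (r ^ d) * ∏ j, auxF (auxA i j) (r * extCoord x j))
      = (simplexDelta d).indicator (fun x => ENNReal.ofReal K * ENNReal.ofReal (G x)) x := by
    intro x
    by_cases h : ∀ j, 0 < extCoord x j
    · rw [indicator_of_mem ((mem_simplexDelta_iff x).2 fun j => (h j).le),
        aux_inner d _ _ (auxA_pos i) h, ← ENNReal.ofReal_mul hKpos.le, auxA_sum, ← hn2,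
        auxA_prod i _ h, hGpos x h]
      congr 1
      have hS : 0 < ∑ j, 1 / extCoord x j :=
        Finset.sum_pos (fun j _ => one_div_pos.2 (h j)) Finset.univ_nonempty
      have hSn : 0 < (∑ j, 1 / extCoord x j) ^ n2 := Real.rpow_pos_of_pos hS _
      rw [Real.rpow_neg hS.le, Real.rpow_add hS, Real.rpow_two, hK]
      generalize (∑ j, 1 / extCoord x j) ^ n2 = T at *
      generalize (∑ j, 1 / extCoord x j) = S at *
      generalize ∏ j, extCoord x j ^ (-(3 : ℝ) / 2) = Q
      have := h i.castSucc
      field_simp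
    · have hr : (simplexDelta d).indicator
          (fun x => ENNReal.ofReal K * ENNReal.ofReal (G x)) x = 0 := by
        by_cases hx : x ∈ simplexDelta d
        · rw [indicator_of_mem hx, hzero x hx h]
          simp
        · exact indicator_of_notMem hx _
      rw [hr, ← lintegral_zero (μ := volume.restrict (Ioi (0:ℝ)))]
      refine setLIntegral_congr_fun measurableSet_Ioi ?_
      intro r hr
      have hr : 0 < r := hr
      push Not at h
      obtain ⟨j, hj⟩ := h
      dsimp only
      rw [Finset.prod_eq_zero (Finset.mem_univ j), mul_zero]
      exact auxF_nonpos (mul_nonpos_of_nonneg_of_nonpos hr.le hj)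
  rw [aux_prod _ _ (fun j => auxF_meas _), Finset.prod_congr rfl fun j _ => auxF_int (auxA_pos i j),
    ← ENNReal.ofReal_prod_of_nonneg (fun j _ => (Real.Gamma_pos_of_pos (auxA_pos i j)).le),
    auxA_gamma, ← hn2, lintegral_congr hin, lintegral_indicator (simplexDelta_meas d),
    lintegral_const_mul' _ _ ENNReal.ofReal_ne_top] at hcone
  have hI := integral_eq_lintegral_of_nonneg_ae (μ := volume.restrict (simplexDelta d)) (f := G)
    ((ae_restrict_mem (simplexDelta_meas d)).mono hGnn) hGm.aestronglyMeasurable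
  rw [hI]
  have hc := congrArg ENNReal.toReal hcone
  rw [ENNReal.toReal_mul, ENNReal.toReal_ofReal (by positivity),
    ENNReal.toReal_ofReal hKpos.le] at hc
  have hgam : Real.Gamma (n2 + 2) = (n2 + 1) * (n2 * Real.Gamma n2) := by
    rw [show n2 + 2 = (n2 + 1) + 1 by ring, Real.Gamma_add_one (by positivity),
      Real.Gamma_add_one (by positivity)]
  have hK2 : K = (n2 + 1) * n2 * Real.pi ^ n2 := by
    rw [hK, hgam]
    field_simp
  rw [hK2] at hc
  have hval : (∫⁻ a in simplexDelta d, ENNReal.ofReal (G a)).toReal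
      = (3 / 4) / ((n2 + 1) * n2) := by
    rw [eq_div_iff (by positivity)]
    have := hpi.ne'
    apply mul_left_cancel₀ this
    rw [hc]
    ring
  rw [hval, hn2]
  field_simp
  ring
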